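/- arXiv:2512.24458 — 2 statements merged into one kernel-verified Lean document; each statement's English description precedes it below -/
import Mathlib

section
/- (Little Picard theorem, stated as Theorem 1.16 of the paper.) Every holomorphic function f : ℂ → ℂ whose image omits the two values 0 and 1 (that is, f(z) ≠ 0 and f(z) ≠ 1 for every z ∈ ℂ) is constant. Equivalently, any holomorphic map from ℂ to ℙ¹ ∖ {0, 1, ∞} is constant. -/
open Metric Set in
/-- A holomorphic function on a disc whose derivative is bounded by twice its size at the centre
covers a disc of radius proportional to `r * ‖deriv f c‖`. -/
theorem ball_subset_image_of_norm_deriv_le_two_mul {f : ℂ → ℂ} {c : ℂ} {r : ℝ} (hr : 0 < r)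
    (hf : DifferentiableOn ℂ f (ball c r)) (hc : deriv f c ≠ 0)
    (hbound : ∀ z ∈ ball c r, ‖deriv f z‖ ≤ 2 * ‖deriv f c‖) :
    ball (f c) (r * ‖deriv f c‖ / 24) ⊆ f '' ball c r := by
  set M := ‖deriv f c‖ with hM
  have hM0 : 0 < M := norm_pos_iff.2 hc
  have hsub : closedBall c (r / 6) ⊆ ball c r := closedBall_subset_ball (by linarith)
  have hdiff : ∀ z ∈ ball c r, DifferentiableAt ℂ f z := fun z hz =>
    hf.differentiableAt (isOpen_ball.mem_nhds hz)
  have hmaps : MapsTo (deriv f) (ball c r) (closedBall (deriv f c) (3 * M)) := fun z hz => by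
    rw [mem_closedBall, dist_eq_norm]
    linarith [norm_sub_le (deriv f z) (deriv f c), hbound z hz]
  have hderiv : ∀ z ∈ closedBall c (r / 6),
      ‖deriv (fun w => f w - deriv f c * w) z‖ ≤ M / 2 := fun z hz => by
    have hd : HasDerivAt (fun w => f w - deriv f c * w) (deriv f z - deriv f c) z := by
      simpa only [id, mul_one] using
        (hdiff z (hsub hz)).hasDerivAt.fun_sub ((hasDerivAt_id z).const_mul (deriv f c))
    rw [hd.deriv, ← dist_eq_norm]
    calc dist (deriv f z) (deriv f c) ≤ 3 * M / r * dist z c :=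
          Complex.dist_le_div_mul_dist_of_mapsTo_ball (hf.deriv isOpen_ball) hmaps (hsub hz)
      _ ≤ 3 * M / r * (r / 6) := by gcongr; exact hz
      _ = M / 2 := by field_simp; norm_num
  have hsphere : ∀ z ∈ sphere c (r / 6), r * M / 12 ≤ ‖f z - f c‖ := fun z hz => by
    have hzc : ‖z - c‖ = r / 6 := by rwa [← dist_eq_norm]
    have h := (convex_closedBall c (r / 6)).norm_image_sub_le_of_norm_deriv_le
      (fun w hw => (hdiff w (hsub hw)).fun_sub (differentiableAt_id.const_mul _)) hderiv
      (mem_closedBall_self (by positivity)) (sphere_subset_closedBall hz)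
    have hlin : ‖deriv f c * (z - c)‖ = M * (r / 6) := by rw [norm_mul, hzc]
    have htri := norm_sub_le (f z - f c)
      ((f z - deriv f c * z) - (f c - deriv f c * c))
    have heq : f z - f c - ((f z - deriv f c * z) - (f c - deriv f c * c)) =
      deriv f c * (z - c) := by ring
    rw [heq, hlin] at htri
    rw [hzc] at h
    linarith
  have hne : ∃ᶠ z in nhds c, f z ≠ f c :=
    ((hdiff c (mem_ball_self hr)).hasDerivAt.eventually_ne hc).frequently.filter_mono
      nhdsWithin_le_nhds
  have hcover := (hf.diffContOnCl_ball hsub).ball_subset_image_closedBall (by positivity)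
    hsphere hne
  rw [show r * M / 12 / 2 = r * M / 24 by ring] at hcover
  exact hcover.trans (image_mono hsub)

open Metric Set in
/-- A weak form of **Bloch's theorem** for entire functions, with an explicit covered radius. -/
theorem Complex.exists_ball_subset_range_of_differentiable {f : ℂ → ℂ} (hf : Differentiable ℂ f) {a : ℂ}
    (ha : deriv f a ≠ 0) {R : ℝ} (hR : 0 < R) :
    ∃ w, ball w (R * ‖deriv f a‖ / 48) ⊆ range f := by
  have hcont : Continuous fun z => ‖deriv f z‖ * (R - dist z a) := by
    have : Continuous (deriv f) := (hf.contDiff (n := 1)).continuous_deriv le_rfl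
    fun_prop
  obtain ⟨p, hp, hmax⟩ := (isCompact_closedBall a R).exists_isMaxOn
    ⟨a, mem_closedBall_self hR.le⟩ hcont.continuousOn
  have hap : ‖deriv f a‖ * R ≤ ‖deriv f p‖ * (R - dist p a) := by
    simpa using hmax (mem_closedBall_self hR.le)
  have hprod : 0 < ‖deriv f p‖ * (R - dist p a) :=
    (mul_pos (norm_pos_iff.2 ha) hR).trans_le hap
  have hp0 : 0 < ‖deriv f p‖ := pos_of_mul_pos_left hprod (sub_nonneg.2 hp)
  have ht : 0 < R - dist p a := pos_of_mul_pos_right hprod hp0.le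
  have hbound : ∀ z ∈ ball p ((R - dist p a) / 2), ‖deriv f z‖ ≤ 2 * ‖deriv f p‖ := by
    intro z hz
    have hza : (R - dist p a) / 2 ≤ R - dist z a := by
      linarith [dist_triangle z p a, mem_ball.1 hz]
    have hzmax : ‖deriv f z‖ * (R - dist z a) ≤ ‖deriv f p‖ * (R - dist p a) :=
      hmax (mem_closedBall.2 (by linarith))
    have := mul_le_mul_of_nonneg_left hza (norm_nonneg (deriv f z))
    refine le_of_mul_le_mul_right ?_ ht
    linarith
  refine ⟨f p, (ball_subset_ball ?_).trans
    ((ball_subset_image_of_norm_deriv_le_two_mul (half_pos ht) hf.differentiableOn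
      (norm_pos_iff.1 hp0) hbound).trans (image_subset_range _ _))⟩
  linarith

open Metric Set in
/-- An entire function whose range contains no disc of radius `r` is constant. -/
theorem Complex.apply_eq_apply_of_not_ball_subset_range_of_differentiable {f : ℂ → ℂ}
    (hf : Differentiable ℂ f) {r : ℝ} (hr : 0 < r) (h : ∀ w, ¬ ball w r ⊆ range f) (x y : ℂ) :
    f x = f y := by
  refine is_const_of_deriv_eq_zero hf (fun a => ?_) x y
  by_contra ha
  have ha' : 0 < ‖deriv f a‖ := norm_pos_iff.2 ha
  obtain ⟨w, hw⟩ := Complex.exists_ball_subset_range_of_differentiable hf ha (R := 48 * r / ‖deriv f a‖) (by positivity)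
  refine h w ?_
  rwa [show 48 * r / ‖deriv f a‖ * ‖deriv f a‖ / 48 = r by field_simp] at hw

/-- A nowhere vanishing entire function has an entire logarithm. -/
theorem Complex.exists_exp_eq_of_differentiable {f : ℂ → ℂ} (hf : Differentiable ℂ f) (h0 : ∀ z, f z ≠ 0) :
    ∃ g : ℂ → ℂ, Differentiable ℂ g ∧ ∀ z, Complex.exp (g z) = f z := by
  have hlog : Differentiable ℂ fun z => deriv f z / f z := by
    have : Differentiable ℂ (deriv f) := fun z =>
      ((hf.differentiableOn.deriv isOpen_univ).differentiableAt Filter.univ_mem)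
    exact this.div hf h0
  obtain ⟨g, hg0, hg⟩ := hlog.isExactOn_univ.with_val_at 0 (Complex.log (f 0))
  have hg' : ∀ z, HasDerivAt g (deriv f z / f z) z := fun z => hg z (Set.mem_univ z)
  refine ⟨g, fun z => (hg' z).differentiableAt, fun z => ?_⟩
  have hd : ∀ w, HasDerivAt (fun w => f w * Complex.exp (-g w)) 0 w := fun w => by
    refine ((hf w).hasDerivAt.fun_mul (hg' w).fun_neg.cexp).congr_deriv ?_
    have := h0 w
    field_simp
    ring
  have hconst := is_const_of_deriv_eq_zero (fun w => (hd w).differentiableAt)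
    (fun w => (hd w).deriv) z 0
  simp only [hg0, Complex.exp_neg, Complex.exp_log (h0 0), mul_inv_cancel₀ (h0 0)] at hconst
  exact ((mul_inv_eq_one₀ (Complex.exp_ne_zero _)).1 hconst).symm

/-- An entire function omitting `1` and `-1` is the hyperbolic cosine of an entire function. -/
theorem Complex.exists_cosh_eq_of_differentiable {f : ℂ → ℂ} (hf : Differentiable ℂ f)
    (h1 : ∀ z, f z ≠ 1) (h2 : ∀ z, f z ≠ -1) :
    ∃ g : ℂ → ℂ, Differentiable ℂ g ∧ ∀ z, Complex.cosh (g z) = f z := by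
  obtain ⟨l, hl, hle⟩ := Complex.exists_exp_eq_of_differentiable
    (show Differentiable ℂ fun z => f z ^ 2 - 1 by fun_prop) (fun z hz => by
      rcases mul_eq_zero.1 (show (f z - 1) * (f z + 1) = 0 by linear_combination hz) with h | h
      · exact h1 z (sub_eq_zero.1 h)
      · exact h2 z (eq_neg_of_add_eq_zero_left h))
  have hsq : ∀ z, Complex.exp (l z / 2) ^ 2 = f z ^ 2 - 1 := fun z => by
    rw [← hle z, ← Complex.exp_nat_mul]
    congr 1
    push_cast
    ring
  have hmul : ∀ z, (f z + Complex.exp (l z / 2)) * (f z - Complex.exp (l z / 2)) = 1 :=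
    fun z => by linear_combination -hsq z
  obtain ⟨g, hg, hge⟩ :=
    Complex.exists_exp_eq_of_differentiable
      (show Differentiable ℂ fun z => f z + Complex.exp (l z / 2) by fun_prop)
      (fun z => left_ne_zero_of_mul_eq_one (hmul z))
  refine ⟨g, hg, fun z => ?_⟩
  rw [Complex.cosh, Complex.exp_neg, hge, inv_eq_of_mul_eq_one_right (hmul z)]
  ring

/-- Below every nonnegative real number, at distance at most `2`, there is a point where `cosh`
takes an odd integer value. -/
theorem Real.exists_cosh_eq_odd {x : ℝ} (hx : 0 ≤ x) :
    ∃ a : ℝ, ∃ k : ℤ, Odd k ∧ Real.cosh a = k ∧ |a - x| ≤ 2 := by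
  obtain ⟨m, hm1, hm2⟩ : ∃ m : ℤ, (m : ℝ) ≤ (Real.cosh x - 1) / 2 ∧
      (Real.cosh x - 1) / 2 < m + 1 := ⟨_, Int.floor_le _, Int.lt_floor_add_one _⟩
  have hm0 : (0 : ℝ) ≤ m := by
    have : (-1 : ℝ) < m := by linarith [Real.one_le_cosh x]
    have : -1 < m := by exact_mod_cast this
    exact_mod_cast (by lia : 0 ≤ m)
  have hk : (1 : ℝ) ≤ 2 * m + 1 := by linarith
  set a := Real.arcosh (2 * m + 1) with ha
  have ha0 : 0 ≤ a := Real.arcosh_nonneg hk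
  have hca : Real.cosh a = 2 * m + 1 := Real.cosh_arcosh hk
  refine ⟨a, 2 * m + 1, odd_two_mul_add_one m, by push_cast; exact hca, ?_⟩
  have hle : a ≤ x := by
    have : |a| ≤ |x| := Real.cosh_le_cosh.1 (by linarith)
    rwa [abs_of_nonneg ha0, abs_of_nonneg hx] at this
  have hlt : x < a + 2 := by
    have hcosh2 : 3 ≤ Real.cosh 2 := by
      have h1 : Real.exp 2 = Real.exp 1 * Real.exp 1 := by rw [← Real.exp_add]; norm_num
      rw [Real.cosh_eq]
      nlinarith [Real.exp_one_gt_d9, Real.exp_pos (-2)]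
    have hadd : Real.cosh x < Real.cosh (a + 2) := by
      rw [Real.cosh_add]
      nlinarith [mul_nonneg (Real.sinh_nonneg_iff.2 ha0)
        (Real.sinh_nonneg_iff.2 (zero_le_two (α := ℝ)))]
    have := Real.cosh_lt_cosh.1 hadd
    rwa [abs_of_nonneg hx, abs_of_nonneg (by linarith)] at this
  rw [abs_le]
  constructor <;> linarith

/-- The points where the complex `cosh` takes an odd integer value form a `6`-dense set. -/
theorem Complex.exists_cosh_eq_odd (w : ℂ) :
    ∃ p ∈ Metric.ball w 6, ∃ k : ℤ, Odd k ∧ Complex.cosh p = k := by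
  obtain ⟨a, k, hk, hak, haw⟩ :
      ∃ a : ℝ, ∃ k : ℤ, Odd k ∧ Real.cosh a = k ∧ |a - w.re| ≤ 2 := by
    obtain ⟨a, k, hk, hak, haw⟩ := Real.exists_cosh_eq_odd (abs_nonneg w.re)
    rcases abs_cases w.re with ⟨h, -⟩ | ⟨h, -⟩
    · exact ⟨a, k, hk, hak, h ▸ haw⟩
    · refine ⟨-a, k, hk, by rwa [Real.cosh_neg], ?_⟩
      rw [h, ← abs_neg] at haw
      convert haw using 2
      ring
  set n : ℤ := round (w.im / Real.pi)
  have hn : |n * Real.pi - w.im| ≤ 2 := by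
    have h := abs_sub_round (w.im / Real.pi)
    have heq : n * Real.pi - w.im = -((w.im / Real.pi - n) * Real.pi) := by
      field_simp [Real.pi_ne_zero]
      ring
    rw [heq, abs_neg, abs_mul, abs_of_pos Real.pi_pos]
    nlinarith [Real.pi_pos, Real.pi_lt_d2]
  have hp : Complex.cosh (a + (n * Real.pi : ℝ) * Complex.I) = ((-1) ^ n * k : ℂ) := by
    rw [Complex.cosh_add, Complex.cosh_mul_I, Complex.sinh_mul_I, ← Complex.ofReal_cos,
      ← Complex.ofReal_sin, Real.cos_int_mul_pi, Real.sin_int_mul_pi, ← Complex.ofReal_cosh, hak]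
    push_cast
    ring
  refine ⟨a + (n * Real.pi : ℝ) * Complex.I, ?_, ?_⟩
  · rw [Metric.mem_ball, dist_eq_norm]
    have := Complex.norm_le_abs_re_add_abs_im (a + (n * Real.pi : ℝ) * Complex.I - w)
    simp only [Complex.sub_re, Complex.sub_im, Complex.add_re, Complex.add_im,
      Complex.ofReal_re, Complex.ofReal_im, Complex.re_ofReal_mul, Complex.im_ofReal_mul,
      Complex.I_re, Complex.I_im, mul_zero, mul_one, add_zero, zero_add] at this
    linarith
  · rcases Int.even_or_odd n with hn | hn
    · exact ⟨k, hk, by rw [hp, hn.neg_one_zpow, one_mul]⟩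
    · exact ⟨-k, hk.neg, by rw [hp, hn.neg_one_zpow]; push_cast; ring⟩

/-- **Little Picard theorem.** Every entire function `f : ℂ → ℂ` omitting the two
values `0` and `1` is constant. -/
theorem little_picard (f : ℂ → ℂ) (hf : Differentiable ℂ f)
    (h0 : ∀ z : ℂ, f z ≠ 0) (h1 : ∀ z : ℂ, f z ≠ 1) :
    ∃ c : ℂ, ∀ z : ℂ, f z = c := by
  obtain ⟨l, hl, hle⟩ := Complex.exists_exp_eq_of_differentiable hf h0
  have hl_int : ∀ z (m : ℤ), l z ≠ m * (2 * Real.pi * Complex.I) := fun z m hz =>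
    h1 z (by rw [← hle z]; exact Complex.exp_eq_one_iff.2 ⟨m, hz⟩)
  have hodd : ∀ z (k : ℤ), Odd k → l z / (Real.pi * Complex.I) - 1 ≠ k := by
    rintro z _ ⟨m, rfl⟩ hz
    refine hl_int z (m + 1) ?_
    have hpi : (Real.pi * Complex.I : ℂ) ≠ 0 := by simp [Real.pi_ne_zero]
    rw [sub_eq_iff_eq_add, div_eq_iff hpi] at hz
    rw [hz]
    push_cast
    ring
  obtain ⟨g, hg, hge⟩ :=
    Complex.exists_cosh_eq_of_differentiable
      (show Differentiable ℂ fun z => l z / (Real.pi * Complex.I) - 1 by fun_prop)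
      (fun z => by simpa using hodd z 1 odd_one)
      (fun z => by simpa using hodd z (-1) odd_one.neg)
  have hconst := Complex.apply_eq_apply_of_not_ball_subset_range_of_differentiable hg
    (r := 6) (by norm_num) fun w hw => by
    obtain ⟨p, hp, k, hk, hpk⟩ := Complex.exists_cosh_eq_odd w
    obtain ⟨z, rfl⟩ := hw hp
    exact hodd z k hk ((hge z).symm.trans hpk)
  refine ⟨f 0, fun z => ?_⟩
  have hlz : l z = l 0 := by
    have h := (hge z).symm.trans ((congrArg Complex.cosh (hconst z 0)).trans (hge 0))
    exact (div_left_inj' (by simp [Real.pi_ne_zero])).1 (sub_left_inj.1 h)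
  rw [← hle z, hlz, hle]
end

section
/- (Great Picard theorem, stated as Theorem 1.17 of the paper.) Let f be a function holomorphic on the punctured unit disk 𝔻* = {z ∈ ℂ : 0 < |z| < 1} such that f(z) ≠ 0 and f(z) ≠ 1 for all z ∈ 𝔻*. Then f does not have an essential singularity at the origin: either there exists c ∈ ℂ such that f(z) → c as z → 0 in 𝔻*, or |f(z)| → ∞ as z → 0 in 𝔻*. In particular f extends to a holomorphic map from the disk 𝔻 to the Riemann sphere ℙ¹. -/
open Complex Metric Set Filter Topology

/-- A form of **Bloch's theorem**: a holomorphic function on a disc whose image contains no disc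
of radius `ρ` has its derivative at the centre bounded in terms of `ρ` and the radius. -/
theorem mul_norm_deriv_le_of_forall_exists_notMem_image {g : ℂ → ℂ} {z₀ : ℂ} {r R ρ : ℝ}
    (hr : 0 < r) (hrR : r < R) (hg : DifferentiableOn ℂ g (ball z₀ R))
    (hρ : ∀ c, ∃ a ∈ ball c ρ, a ∉ g '' ball z₀ R) :
    r * ‖deriv g z₀‖ ≤ 48 * ρ := by
  have hsub : closedBall z₀ r ⊆ ball z₀ R := closedBall_subset_ball hrR
  have hdiff : ∀ z ∈ ball z₀ R, DifferentiableAt ℂ g z := fun z hz =>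
    hg.differentiableAt (isOpen_ball.mem_nhds hz)
  have hg' : DifferentiableOn ℂ (deriv g) (ball z₀ R) := hg.deriv isOpen_ball
  obtain ⟨p, hp, hmax⟩ := (isCompact_closedBall z₀ r).exists_isMaxOn
    ⟨z₀, mem_closedBall_self hr.le⟩
    (f := fun z => (r - dist z z₀) * ‖deriv g z‖)
    ((continuousOn_const.sub (continuous_id.dist continuous_const).continuousOn).mul
      (hg'.continuousOn.mono hsub).norm)
  have hmax' : ∀ z ∈ closedBall z₀ r,
      (r - dist z z₀) * ‖deriv g z‖ ≤ (r - dist p z₀) * ‖deriv g p‖ := fun z hz => hmax hz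
  have h₀ := hmax' z₀ (mem_closedBall_self hr.le)
  rw [dist_self, sub_zero] at h₀
  refine h₀.trans ?_
  obtain ⟨a₀, ha₀, -⟩ := hρ 0
  have hρ0 : 0 < ρ := pos_of_mem_ball ha₀
  rcases eq_or_ne (deriv g p) 0 with hd0 | hd0
  · simp [hd0, hρ0.le]
  rcases (mem_closedBall.1 hp).eq_or_lt with hpr | hpr
  · simp [hpr, hρ0.le]
  set d := ‖deriv g p‖ with hd
  have hdpos : 0 < d := norm_pos_iff.2 hd0
  set t := (r - dist p z₀) / 2 with ht
  have htpos : 0 < t := by rw [ht]; linarith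
  have hball : ball p t ⊆ closedBall z₀ r := fun z hz => by
    have := dist_triangle z p z₀
    rw [mem_ball] at hz
    rw [mem_closedBall]
    linarith
  have hderiv : ∀ z ∈ ball p t, ‖deriv g z‖ ≤ 2 * d := fun z hz => by
    have h1 := hmax' z (hball hz)
    have h2 := dist_triangle z p z₀
    rw [mem_ball] at hz
    have h3 : t ≤ r - dist z z₀ := by linarith
    have h4 : t * ‖deriv g z‖ ≤ t * (2 * d) := by
      have := mul_le_mul_of_nonneg_right h3 (norm_nonneg (deriv g z))
      have e : (r - dist p z₀) * d = t * (2 * d) := by rw [ht]; ring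
      linarith
    exact le_of_mul_le_mul_left h4 htpos
  have hmaps : MapsTo (deriv g) (ball p t) (closedBall (deriv g p) (3 * d)) := fun z hz => by
    rw [mem_closedBall, dist_eq_norm]
    have := norm_sub_le (deriv g z) (deriv g p)
    have := hderiv z hz
    linarith
  have hsp : closedBall p (t / 6) ⊆ ball p t := closedBall_subset_ball (by linarith)
  have hsmall : ∀ z ∈ closedBall p (t / 6), ‖deriv g z - deriv g p‖ ≤ d / 2 := fun z hz => by
    have h1 := dist_le_div_mul_dist_of_mapsTo_ball (hg'.mono (hball.trans hsub)) hmaps (hsp hz)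
    rw [dist_eq_norm] at h1
    refine h1.trans ?_
    calc 3 * d / t * dist z p ≤ 3 * d / t * (t / 6) :=
          mul_le_mul_of_nonneg_left (mem_closedBall.1 hz) (by positivity)
      _ = d / 2 := by field_simp; norm_num
  have hlow : ∀ z ∈ sphere p (t / 6), d * t / 12 ≤ ‖g z - g p‖ := fun z hz => by
    have hz' := sphere_subset_closedBall hz
    have h1 := (convex_closedBall p (t / 6)).norm_image_sub_le_of_norm_hasDerivWithin_le
      (f := fun z => g z - deriv g p * z) (f' := fun z => deriv g z - deriv g p) (C := d / 2)
      (fun x hx => ((hdiff x (hsub (hball (hsp hx)))).hasDerivAt.sub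
        (by simpa using (hasDerivAt_id x).const_mul (deriv g p))).hasDerivWithinAt)
      hsmall (mem_closedBall_self (by positivity)) hz'
    rw [mem_sphere, dist_eq_norm] at hz
    rw [hz] at h1
    have h2 : ‖deriv g p * (z - p)‖ = d * (t / 6) := by rw [norm_mul, hz]
    have h3 : deriv g p * (z - p) =
      (g z - g p) - ((g z - deriv g p * z) - (g p - deriv g p * p)) := by ring
    have h4 := norm_sub_le (g z - g p) ((g z - deriv g p * z) - (g p - deriv g p * p))
    rw [← h3, h2] at h4
    linarith
  have hpR : p ∈ ball z₀ R := hsub hp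
  have himage := DiffContOnCl.ball_subset_image_closedBall (f := g) (z₀ := p) (r := t / 6)
    (ε := d * t / 12)
    ((hg.mono ((hsp.trans hball).trans hsub)).diffContOnCl_ball subset_rfl) (by positivity) hlow
    (((hdiff p hpR).hasDerivAt.eventually_ne hd0).frequently.filter_mono nhdsWithin_le_nhds)
  obtain ⟨a, ha, hna⟩ := hρ (g p)
  by_contra! hlt
  refine hna (image_mono ((hsp.trans hball).trans hsub) (himage (ball_subset_ball ?_ ha)))
  have e : (r - dist p z₀) * d = t * (2 * d) := by rw [ht]; ring
  linarith

/-- The points at which `cosh ^ 2` is an integer form a `5`-net in the plane. -/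
theorem exists_mem_ball_cosh_sq_eq_intCast (c : ℂ) :
    ∃ a ∈ ball c 5, ∃ n : ℤ, cosh a ^ 2 = n := by
  wlog hc : 0 ≤ c.re generalizing c
  · obtain ⟨a, ha, n, hn⟩ := this (-c) (by simp; linarith)
    refine ⟨-a, ?_, n, by rwa [cosh_neg]⟩
    rwa [mem_ball, ← dist_neg_neg, neg_neg]
  set x := c.re
  set N : ℕ := ⌊Real.sinh x ^ 2⌋₊
  set α := Real.arsinh (√N)
  have hs : 0 ≤ Real.sinh x := Real.sinh_nonneg_iff.2 hc
  have hα : Real.sinh α = √N := Real.sinh_arsinh _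
  have hα0 : 0 ≤ α := Real.arsinh_nonneg_iff.2 (Real.sqrt_nonneg _)
  have hαx : α ≤ x := by
    rw [← Real.sinh_le_sinh, hα]
    exact Real.sqrt_le_iff.2 ⟨hs, Nat.floor_le (sq_nonneg _)⟩
  have hxα : x - 1 ≤ α := by
    rcases le_or_gt x 1 with h1 | h1
    · linarith
    rw [← Real.sinh_le_sinh, hα]
    apply Real.le_sqrt_of_sq_le
    have h2 : Real.sinh x ^ 2 < N + 1 := Nat.lt_floor_add_one _
    have h3 : Real.sinh x =
        Real.sinh (x - 1) * Real.cosh 1 + Real.cosh (x - 1) * Real.sinh 1 := by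
      rw [← Real.sinh_add]; simp
    have h4 : 0 ≤ Real.sinh (x - 1) := Real.sinh_nonneg_iff.2 (by linarith)
    have h5 : Real.sinh (x - 1) ≤ Real.sinh (x - 1) * Real.cosh 1 :=
      le_mul_of_one_le_right h4 (Real.one_le_cosh 1)
    have h6 : 1 ≤ Real.cosh (x - 1) * Real.sinh 1 :=
      one_le_mul_of_one_le_of_one_le (Real.one_le_cosh _) (Real.self_le_sinh_iff.2 zero_le_one)
    nlinarith
  set m : ℤ := round (c.im / (2 * Real.pi))
  have hm : |c.im - m * (2 * Real.pi)| ≤ Real.pi := by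
    have h1 := abs_sub_round (c.im / (2 * Real.pi))
    have e : c.im - m * (2 * Real.pi) = (c.im / (2 * Real.pi) - m) * (2 * Real.pi) := by
      field_simp
    rw [e, abs_mul, abs_of_pos Real.two_pi_pos]
    have := mul_le_mul_of_nonneg_right h1 Real.two_pi_pos.le
    linarith
  refine ⟨α + m * (2 * Real.pi * I), ?_, N + 1, ?_⟩
  · rw [mem_ball, dist_comm, dist_eq_norm]
    refine (norm_le_abs_re_add_abs_im _).trans_lt ?_
    have h1 : (c - (α + m * (2 * Real.pi * I))).re = x - α := by simp [x]
    have h2 : (c - (α + m * (2 * Real.pi * I))).im = c.im - m * (2 * Real.pi) := by simp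
    rw [h1, h2]
    have : |x - α| ≤ 1 := abs_le.2 ⟨by linarith, by linarith⟩
    linarith [Real.pi_lt_four]
  · have h1 : cosh (α + m * (2 * Real.pi * I)) = cosh α := by
      rw [cosh, cosh, neg_add, ← neg_mul, ← Int.cast_neg, exp_periodic.int_mul m,
        exp_periodic.int_mul (-m)]
    rw [h1, ← ofReal_cosh, ← ofReal_pow, Real.cosh_sq, hα, Real.sq_sqrt (Nat.cast_nonneg _)]
    push_cast
    ring

/-- A nonvanishing holomorphic function on a disc has a holomorphic logarithm with a prescribed
value at the centre. -/
theorem exists_differentiableOn_exp_eq_on_ball {F : ℂ → ℂ} {R : ℝ} {z₀ : ℂ}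
    (hF : DifferentiableOn ℂ F (ball z₀ R)) (h0 : ∀ z ∈ ball z₀ R, F z ≠ 0) :
    ∃ G : ℂ → ℂ, DifferentiableOn ℂ G (ball z₀ R) ∧ G z₀ = log (F z₀) ∧
      ∀ z ∈ ball z₀ R, exp (G z) = F z := by
  have hd : ∀ z ∈ ball z₀ R, HasDerivAt F (deriv F z) z := fun z hz =>
    (hF.differentiableAt (isOpen_ball.mem_nhds hz)).hasDerivAt
  obtain ⟨G, hG0, hG⟩ :=
    (((hF.deriv isOpen_ball).div hF h0).isExactOn_ball).with_val_at z₀ (log (F z₀))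
  refine ⟨G, fun z hz => (hG z hz).differentiableAt.differentiableWithinAt, hG0, fun z hz => ?_⟩
  have hz₀ : z₀ ∈ ball z₀ R := mem_ball_self (pos_of_mem_ball hz)
  have h1 := (convex_ball z₀ R).norm_image_sub_le_of_norm_hasDerivWithin_le
    (f := fun z => F z * exp (-G z)) (f' := fun _ => 0) (C := 0)
    (fun x hx => (((hd x hx).mul (hG x hx).neg.cexp).congr_deriv (by
      have := h0 x hx
      simp only [Pi.div_apply, Pi.neg_apply]
      field_simp
      ring)).hasDerivWithinAt)
    (by simp) hz₀ hz
  rw [zero_mul, norm_le_zero_iff, sub_eq_zero, hG0, exp_neg, exp_neg, exp_log (h0 _ hz₀),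
    mul_inv_cancel₀ (h0 _ hz₀), mul_inv_eq_one₀ (exp_ne_zero _)] at h1
  exact h1.symm

theorem norm_log_le_of_norm_le {z : ℂ} {a : ℝ} (h1 : ‖z‖ ≤ Real.exp a)
    (h2 : Real.exp (-a) ≤ ‖z‖) : ‖log z‖ ≤ a + 4 := by
  have hz : 0 < ‖z‖ := (Real.exp_pos _).trans_le h2
  refine (norm_le_abs_re_add_abs_im _).trans ?_
  rw [log_re, log_im]
  have h3 : |Real.log ‖z‖| ≤ a :=
    abs_le.2 ⟨(Real.le_log_iff_exp_le hz).2 h2, (Real.log_le_iff_le_exp hz).2 h1⟩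
  linarith [abs_arg_le_pi z, Real.pi_lt_four]

/-- A holomorphic function on a disc omitting `0` and `1` is of the form `exp (2 π i cosh² g)`, with
`g` holomorphic and `g` controlled at the centre when the given function is controlled there. -/
theorem exists_eq_exp_cosh_sq {F : ℂ → ℂ} {R : ℝ} (hR : 0 < R)
    (hF : DifferentiableOn ℂ F (ball 0 R)) (h0 : ∀ z ∈ ball 0 R, F z ≠ 0)
    (h1 : ∀ z ∈ ball 0 R, F z ≠ 1) (hl : 1 / 2 ≤ ‖F 0‖) (hu : ‖F 0‖ ≤ 2) :
    ∃ g : ℂ → ℂ, DifferentiableOn ℂ g (ball 0 R) ∧ ‖g 0‖ ≤ 6 ∧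
      ∀ z ∈ ball 0 R, F z = exp (2 * Real.pi * I * cosh (g z) ^ 2) := by
  have h0R : (0 : ℂ) ∈ ball 0 R := mem_ball_self hR
  have he : (2 : ℝ) ≤ Real.exp 1 := by linarith [Real.add_one_le_exp 1]
  obtain ⟨G, hG, hG0, hGF⟩ := exists_differentiableOn_exp_eq_on_ball hF h0
  set h : ℂ → ℂ := fun z => G z / (2 * Real.pi * I) with hh
  have hhd : DifferentiableOn ℂ h (ball 0 R) := hG.div_const _
  have hhF : ∀ z ∈ ball 0 R, F z = exp (2 * Real.pi * I * h z) := fun z hz => by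
    rw [← hGF z hz, hh, mul_div_cancel₀ _ two_pi_I_ne_zero]
  have hh_int : ∀ z ∈ ball 0 R, ∀ n : ℤ, h z ≠ n := fun z hz n hn => by
    refine h1 z hz ?_
    rw [hhF z hz, hn, mul_comm]
    exact exp_int_mul_two_pi_mul_I n
  have hh0 : ‖h 0‖ ≤ 1 := by
    have hlog : ‖log (F 0)‖ ≤ 1 + 4 := norm_log_le_of_norm_le (hu.trans he) (by
      rw [Real.exp_neg]
      refine le_trans ?_ hl
      rw [one_div]
      exact inv_anti₀ two_pos he)
    simp only [hh, hG0, norm_div]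
    refine div_le_one_of_le₀ (hlog.trans ?_) (norm_nonneg _)
    simp only [norm_mul, norm_I, norm_real, Real.norm_eq_abs, abs_of_pos Real.pi_pos]
    norm_num
    linarith [Real.pi_gt_three]
  obtain ⟨P, hP, -, hPh⟩ := exists_differentiableOn_exp_eq_on_ball hhd
    fun z hz => by simpa using hh_int z hz 0
  obtain ⟨Q, hQ, -, hQh⟩ := exists_differentiableOn_exp_eq_on_ball (hhd.sub_const 1)
    fun z hz => by simpa [sub_eq_zero] using hh_int z hz 1
  have hsqP : ∀ z ∈ ball 0 R, exp (P z / 2) ^ 2 = h z := fun z hz => by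
    rw [← hPh z hz, ← exp_nat_mul]; congr 1; push_cast; ring
  have hsqQ : ∀ z ∈ ball 0 R, exp (Q z / 2) ^ 2 = h z - 1 := fun z hz => by
    rw [← hQh z hz, ← exp_nat_mul]; congr 1; push_cast; ring
  have hprod : ∀ z ∈ ball 0 R, (exp (P z / 2) + exp (Q z / 2)) *
      (exp (P z / 2) - exp (Q z / 2)) = 1 := fun z hz => by
    linear_combination hsqP z hz - hsqQ z hz
  obtain ⟨g, hg, hg0, hgK⟩ := exists_differentiableOn_exp_eq_on_ball
    (F := fun z => exp (P z / 2) + exp (Q z / 2)) (z₀ := 0) (R := R)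
    ((hP.div_const 2).cexp.add (hQ.div_const 2).cexp)
    fun z hz => left_ne_zero_of_mul_eq_one (hprod z hz)
  refine ⟨g, hg, ?_, fun z hz => ?_⟩
  · have hp : ‖exp (P 0 / 2)‖ ≤ 1 := by
      have := congrArg norm (hsqP 0 h0R)
      rw [norm_pow] at this
      exact (sq_le_one_iff₀ (norm_nonneg _)).1 (this.trans_le hh0)
    have hq : ‖exp (Q 0 / 2)‖ ≤ 2 := by
      have := congrArg norm (hsqQ 0 h0R)
      rw [norm_pow] at this
      have h2 := norm_sub_le (h 0) 1
      rw [norm_one] at h2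
      nlinarith [norm_nonneg (exp (Q 0 / 2))]
    have he2 : (3 : ℝ) ≤ Real.exp 2 := by linarith [Real.add_one_le_exp 2]
    have hadd := norm_add_le (exp (P 0 / 2)) (exp (Q 0 / 2))
    have hsub := norm_sub_le (exp (P 0 / 2)) (exp (Q 0 / 2))
    have hn := congrArg norm (hprod 0 h0R)
    rw [norm_mul, norm_one] at hn
    rw [hg0]
    refine (norm_log_le_of_norm_le (a := 2) (by linarith) ?_).trans (by norm_num)
    rw [Real.exp_neg, eq_inv_of_mul_eq_one_left hn]
    have hpos : 0 < ‖exp (P 0 / 2) - exp (Q 0 / 2)‖ :=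
      norm_pos_iff.2 (right_ne_zero_of_mul_eq_one (hprod 0 h0R))
    exact inv_anti₀ hpos (by linarith)
  · rw [hhF z hz, ← hsqP z hz, cosh, exp_neg, hgK z hz,
      inv_eq_of_mul_eq_one_right (hprod z hz)]
    ring_nf

/-- A form of **Schottky's theorem**. -/
theorem exists_norm_le_of_omits_zero_one :
    ∃ C : ℝ, ∀ F : ℂ → ℂ, DifferentiableOn ℂ F (ball 0 16) → (∀ z ∈ ball 0 16, F z ≠ 0) →
      (∀ z ∈ ball 0 16, F z ≠ 1) → 1 / 2 ≤ ‖F 0‖ → ‖F 0‖ ≤ 2 →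
      ∀ z ∈ closedBall 0 4, ‖F z‖ ≤ C := by
  refine ⟨Real.exp (2 * Real.pi * Real.exp 126 ^ 2), fun F hF h0 h1 hl hu z hz => ?_⟩
  obtain ⟨g, hg, hg0, hgF⟩ := exists_eq_exp_cosh_sq (by norm_num) hF h0 h1 hl hu
  have homit : ∀ c : ℂ, ∃ a ∈ ball c 5, a ∉ g '' ball 0 16 := fun c => by
    obtain ⟨a, ha, n, hn⟩ := exists_mem_ball_cosh_sq_eq_intCast c
    refine ⟨a, ha, ?_⟩
    rintro ⟨w, hw, rfl⟩
    refine h1 w hw ?_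
    rw [hgF w hw, hn, mul_comm]
    exact exp_int_mul_two_pi_mul_I n
  have hderiv : ∀ w ∈ closedBall (0 : ℂ) 4, ‖deriv g w‖ ≤ 30 := fun w hw => by
    have hsub : ball w 12 ⊆ ball 0 16 := ball_subset_ball' (by
      rw [mem_closedBall] at hw; linarith)
    have := mul_norm_deriv_le_of_forall_exists_notMem_image (r := 8) (by norm_num) (by norm_num)
      (hg.mono hsub) (fun c => (homit c).imp fun a ha => ⟨ha.1, fun h => ha.2 (image_mono hsub h)⟩)
    linarith
  have hgz : ‖g z‖ ≤ 126 := by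
    have h2 := (convex_closedBall (0 : ℂ) 4).norm_image_sub_le_of_norm_deriv_le
      (fun w hw => hg.differentiableAt (isOpen_ball.mem_nhds
        (closedBall_subset_ball (by norm_num) hw))) hderiv (mem_closedBall_self (by norm_num)) hz
    have h3 := norm_le_norm_add_norm_sub' (g z) (g 0)
    rw [mem_closedBall, dist_eq_norm] at hz
    linarith
  have hcosh : ‖cosh (g z)‖ ≤ Real.exp 126 := by
    have h2 := norm_exp_le_exp_norm (g z)
    have h3 := norm_exp_le_exp_norm (-g z)
    rw [norm_neg] at h3
    have h4 := norm_add_le (exp (g z)) (exp (-g z))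
    have h5 := Real.exp_le_exp.2 hgz
    rw [cosh, norm_div, RCLike.norm_ofNat]
    linarith
  rw [hgF z (closedBall_subset_ball (by norm_num) hz)]
  refine (norm_exp_le_exp_norm _).trans (Real.exp_le_exp.2 ?_)
  simp only [norm_mul, norm_pow, norm_I, norm_real, Real.norm_eq_abs, abs_of_pos Real.pi_pos,
    RCLike.norm_ofNat, mul_one]
  gcongr

theorem exists_tendsto_of_eventually_norm_le {f : ℂ → ℂ}
    (hf : ∀ᶠ z in 𝓝[≠] 0, DifferentiableAt ℂ f z) {C : ℝ} (hC : ∀ᶠ z in 𝓝[≠] 0, ‖f z‖ ≤ C) :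
    ∃ c, Tendsto f (𝓝[≠] 0) (𝓝 c) :=
  ⟨_, tendsto_limUnder_of_differentiable_on_punctured_nhds_of_bounded_under hf
    ⟨C + ‖f 0‖, eventually_map.2 (hC.mono fun z hz => (norm_sub_le _ _).trans (by linarith))⟩⟩

theorem exists_tendsto_or_tendsto_norm_atTop_of_eventually_le_norm {f : ℂ → ℂ}
    (hf : ∀ᶠ z in 𝓝[≠] 0, DifferentiableAt ℂ f z) {C : ℝ} (hC0 : 0 < C)
    (hC : ∀ᶠ z in 𝓝[≠] 0, C ≤ ‖f z‖) :
    (∃ c, Tendsto f (𝓝[≠] 0) (𝓝 c)) ∨ Tendsto (fun z => ‖f z‖) (𝓝[≠] 0) atTop := by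
  have hne : ∀ᶠ z in 𝓝[≠] 0, f z ≠ 0 := hC.mono fun z hz =>
    norm_pos_iff.1 (hC0.trans_le hz)
  obtain ⟨c, hc⟩ := exists_tendsto_of_eventually_norm_le (f := fun z => (f z)⁻¹) (C := C⁻¹)
    (hf.and hne |>.mono fun z hz => hz.1.inv hz.2)
    (hC.mono fun z hz => by rw [norm_inv]; exact inv_anti₀ hC0 hz)
  rcases eq_or_ne c 0 with rfl | hc0
  · right
    have h1 : Tendsto (fun z => ‖(f z)⁻¹‖) (𝓝[≠] 0) (𝓝[>] 0) := by
      refine tendsto_nhdsWithin_iff.2 ⟨by simpa using hc.norm, hne.mono fun z hz => ?_⟩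
      exact norm_pos_iff.2 (inv_ne_zero hz)
    simpa [Function.comp_def] using tendsto_inv_nhdsGT_zero.comp h1
  · left
    exact ⟨c⁻¹, by simpa using hc.inv₀ hc0⟩

/-- If a bound holds on arbitrarily small circles around the puncture, it holds near the
puncture. -/
theorem eventually_norm_le_of_frequently_circle {f : ℂ → ℂ} {R C : ℝ} (hR : 0 < R)
    (hf : DifferentiableOn ℂ f {z | 0 < ‖z‖ ∧ ‖z‖ < R})
    (hC : ∃ᶠ z₀ in 𝓝[≠] (0 : ℂ), ∀ z : ℂ, ‖z‖ = ‖z₀‖ → ‖f z‖ ≤ C) :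
    ∀ᶠ z in 𝓝[≠] 0, ‖f z‖ ≤ C := by
  have key : ∀ r : ℝ, 0 < r → ∃ z₀ : ℂ, 0 < ‖z₀‖ ∧ ‖z₀‖ < r ∧
      ∀ z : ℂ, ‖z‖ = ‖z₀‖ → ‖f z‖ ≤ C := fun r hr => by
    have h1 : ∀ᶠ z : ℂ in 𝓝[≠] 0, 0 < ‖z‖ ∧ ‖z‖ < r := by
      filter_upwards [self_mem_nhdsWithin, nhdsWithin_le_nhds (ball_mem_nhds (0 : ℂ) hr)]
        with z hz hz'
      exact ⟨norm_pos_iff.2 hz, mem_ball_zero_iff.1 hz'⟩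
    obtain ⟨z₀, h2, h3⟩ := (hC.and_eventually h1).exists
    exact ⟨z₀, h3.1, h3.2, h2⟩
  obtain ⟨z₁, h1pos, h1R, h1C⟩ := key R hR
  filter_upwards [self_mem_nhdsWithin, nhdsWithin_le_nhds (ball_mem_nhds (0 : ℂ) h1pos)]
    with z hz hz'
  obtain ⟨z₂, h2pos, h2z, h2C⟩ := key ‖z‖ (norm_pos_iff.2 hz)
  rw [mem_ball_zero_iff] at hz'
  have hclosure : closure {w : ℂ | ‖w‖ ∈ Ioo ‖z₂‖ ‖z₁‖} ⊆ {w | ‖w‖ ∈ Icc ‖z₂‖ ‖z₁‖} :=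
    closure_minimal (fun w hw => Ioo_subset_Icc_self hw) (isClosed_Icc.preimage continuous_norm)
  have hopen : IsOpen {w : ℂ | ‖w‖ ∈ Ioo ‖z₂‖ ‖z₁‖} := isOpen_Ioo.preimage continuous_norm
  refine norm_le_of_forall_mem_frontier_norm_le (U := {w : ℂ | ‖w‖ ∈ Ioo ‖z₂‖ ‖z₁‖})
    (isBounded_ball.subset fun w hw => mem_ball_zero_iff.2 hw.2)
    (hf.mono fun w hw => ?_).diffContOnCl (fun w hw => ?_) (subset_closure ⟨h2z, hz'⟩)
  · have := hclosure hw
    exact ⟨h2pos.trans_le this.1, this.2.trans_lt h1R⟩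
  · rw [hopen.frontier_eq] at hw
    have h3 := hclosure hw.1
    have h4 : ¬ (‖z₂‖ < ‖w‖ ∧ ‖w‖ < ‖z₁‖) := hw.2
    rcases h3.1.eq_or_lt with h5 | h5
    · exact h2C w h5.symm
    · exact h1C w (h3.2.antisymm (not_lt.1 fun h6 => h4 ⟨h5, h6⟩))

/-- **Great Picard theorem.** A function holomorphic on the punctured unit disk
`𝔻* = {z : 0 < |z| < 1}` omitting the values `0` and `1` has no essential
singularity at the origin: either it tends to a finite limit `c ∈ ℂ` as `z → 0`
along `𝔻*`, or its norm tends to infinity as `z → 0` along `𝔻*`. -/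
theorem great_picard (f : ℂ → ℂ)
    (hf : DifferentiableOn ℂ f {z : ℂ | 0 < ‖z‖ ∧ ‖z‖ < 1})
    (h0 : ∀ z ∈ {z : ℂ | 0 < ‖z‖ ∧ ‖z‖ < 1}, f z ≠ 0)
    (h1 : ∀ z ∈ {z : ℂ | 0 < ‖z‖ ∧ ‖z‖ < 1}, f z ≠ 1) :
    (∃ c : ℂ, Filter.Tendsto f (nhdsWithin 0 {z : ℂ | 0 < ‖z‖ ∧ ‖z‖ < 1}) (nhds c)) ∨
      Filter.Tendsto (fun z => ‖f z‖) (nhdsWithin 0 {z : ℂ | 0 < ‖z‖ ∧ ‖z‖ < 1})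
        Filter.atTop := by
  have hS : {z : ℂ | 0 < ‖z‖ ∧ ‖z‖ < 1} = {0}ᶜ ∩ ball 0 1 := by ext; simp
  have hSopen : IsOpen {z : ℂ | 0 < ‖z‖ ∧ ‖z‖ < 1} := hS ▸ isOpen_compl_singleton.inter isOpen_ball
  have hnhds : 𝓝[{z : ℂ | 0 < ‖z‖ ∧ ‖z‖ < 1}] 0 = 𝓝[≠] 0 := by
    rw [hS, inter_comm]
    exact nhdsWithin_inter_of_mem (nhdsWithin_le_nhds (ball_mem_nhds 0 one_pos))
  rw [hnhds]
  have hdiff : ∀ᶠ z in 𝓝[≠] 0, DifferentiableAt ℂ f z := by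
    rw [← hnhds]
    exact eventually_nhdsWithin_of_forall fun z hz => hf.differentiableAt (hSopen.mem_nhds hz)
  have hexp : ∀ w : ℂ, w.re < 0 → exp w ∈ {z : ℂ | 0 < ‖z‖ ∧ ‖z‖ < 1} := fun w hw => by
    simp [norm_exp, hw]
  by_cases hfreq : ∃ᶠ z in 𝓝[≠] 0, 1 / 2 ≤ ‖f z‖ ∧ ‖f z‖ ≤ 2
  · left
    obtain ⟨C, hC⟩ := exists_norm_le_of_omits_zero_one
    refine exists_tendsto_of_eventually_norm_le hdiff
      (eventually_norm_le_of_frequently_circle (C := C) one_pos hf ?_)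
    have hsmall : ∀ᶠ z in 𝓝[≠] (0 : ℂ), z ≠ 0 ∧ ‖z‖ < Real.exp (-16) := by
      filter_upwards [self_mem_nhdsWithin,
        nhdsWithin_le_nhds (ball_mem_nhds (0 : ℂ) (Real.exp_pos (-16)))] with z hz hz'
      exact ⟨hz, mem_ball_zero_iff.1 hz'⟩
    refine (hfreq.and_eventually hsmall).mono ?_
    rintro z₀ ⟨⟨hl, hu⟩, hz₀, hz₀'⟩ z hz
    have hz_ne : z ≠ 0 := norm_pos_iff.1 (hz ▸ norm_pos_iff.2 hz₀)
    have hlog : (log z₀).re < -16 := by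
      rw [log_re]
      exact (Real.log_lt_iff_lt_exp (norm_pos_iff.2 hz₀)).2 hz₀'
    have hre : ∀ w ∈ ball (0 : ℂ) 16, (log z₀ + w).re < 0 := fun w hw => by
      have := re_le_norm w
      rw [mem_ball_zero_iff] at hw
      rw [add_re]
      linarith
    have hcomp : DifferentiableOn ℂ (fun w => f (exp (log z₀ + w))) (ball 0 16) :=
      hf.comp (f := fun w => exp (log z₀ + w)) (by fun_prop) fun w hw => hexp _ (hre w hw)
    have := hC _ hcomp (fun w hw => h0 _ (hexp _ (hre w hw)))
      (fun w hw => h1 _ (hexp _ (hre w hw))) (by simpa [exp_log hz₀] using hl)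
      (by simpa [exp_log hz₀] using hu) (arg (z / z₀) * I) (by
        rw [mem_closedBall_zero_iff, norm_mul, norm_I, mul_one, norm_real]
        exact (abs_arg_le_pi _).trans Real.pi_lt_four.le)
    have hn : ‖z / z₀‖ = 1 := by rw [norm_div, hz, div_self (norm_ne_zero_iff.2 hz₀)]
    have harg : exp (arg (z / z₀) * I) = z / z₀ := by
      have := norm_mul_exp_arg_mul_I (z / z₀)
      rwa [hn, ofReal_one, one_mul] at this
    rwa [exp_add, exp_log hz₀, harg, mul_div_cancel₀ _ hz₀] at this
  · have hev : ∀ᶠ z in 𝓝[≠] 0, ¬ (1 / 2 ≤ ‖f z‖ ∧ ‖f z‖ ≤ 2) := not_frequently.1 hfreq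
    obtain ⟨δ, hδ, hδf⟩ := Metric.eventually_nhds_iff.1 (eventually_nhdsWithin_iff.1 hev)
    set L := min (Real.log δ) 0
    have hconn : IsPreconnected {w : ℂ | w.re < L} := (convex_halfSpace_re_lt L).isPreconnected
    have hcont : ContinuousOn (fun w => ‖f (exp w)‖) {w : ℂ | w.re < L} :=
      (hf.continuousOn.comp (f := exp) continuous_exp.continuousOn
        fun w hw => hexp w (hw.trans_le (min_le_right _ _))).norm
    have hval : ∀ w ∈ {w : ℂ | w.re < L}, ¬ (1 / 2 ≤ ‖f (exp w)‖ ∧ ‖f (exp w)‖ ≤ 2) :=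
      fun w hw => hδf (by
        rw [dist_zero_right, norm_exp]
        exact (Real.lt_log_iff_exp_lt hδ).1 (lt_of_lt_of_le hw (min_le_left _ _)))
        (exp_ne_zero w)
    have hnear : ∀ᶠ z : ℂ in 𝓝[≠] 0, z ≠ 0 ∧ (log z).re < L := by
      filter_upwards [self_mem_nhdsWithin,
        nhdsWithin_le_nhds (ball_mem_nhds (0 : ℂ) (Real.exp_pos L))] with z hz hz'
      refine ⟨hz, ?_⟩
      rw [log_re]
      exact (Real.log_lt_iff_lt_exp (norm_pos_iff.2 hz)).2 (mem_ball_zero_iff.1 hz')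
    by_cases hbig : ∃ w ∈ {w : ℂ | w.re < L}, 2 < ‖f (exp w)‖
    · obtain ⟨w, hw, hw2⟩ := hbig
      refine exists_tendsto_or_tendsto_norm_atTop_of_eventually_le_norm hdiff
        (C := 1 / 2) (by norm_num) (hnear.mono fun z hz => ?_)
      by_contra! hlt
      obtain ⟨v, hv, hv1⟩ := hconn.intermediate_value hz.2 hw hcont
        (show (1 : ℝ) ∈ Icc _ _ from ⟨by rw [exp_log hz.1]; linarith, by linarith⟩)
      exact hval v hv (by simp only at hv1; rw [hv1]; norm_num)
    · left
      push Not at hbig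
      exact exists_tendsto_of_eventually_norm_le hdiff (hnear.mono fun z hz => by
        simpa [exp_log hz.1] using hbig _ hz.2)
end
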